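/- arXiv:1805.08764 — 2 statements merged into one kernel-verified Lean document; each statement's English description precedes it below -/
import Mathlib

section
/- For every non-degenerate triple (M, e, Λ), the surface gravities of the Cauchy horizon and of the event horizon satisfy κ₋ > κ₊. -/
noncomputable section

/-- The metric coefficient `μ(r) = 1 - 2M/r + e²/r² - (Λ/3)r²`. -/
def mu (M e Λ : ℝ) (r : ℝ) : ℝ := 1 - 2*M/r + e^2/r^2 - (Λ/3)*r^2

/-- Surface gravity of the event horizon: `κ₊ = (1/2)·μ′(r₊)`. -/
def kappaP (M e Λ rp : ℝ) : ℝ := (1/2) * deriv (mu M e Λ) rp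

/-- Surface gravity of the Cauchy horizon: `κ₋ = -(1/2)·μ′(r₋)`. -/
def kappaM (M e Λ rm : ℝ) : ℝ := -(1/2) * deriv (mu M e Λ) rm

/-- At a zero `r ≠ 0` of `μ`, the polynomial `r² μ(r)` vanishes. -/
lemma quartic_eq_zero_of_mu_eq_zero {M e Λ r : ℝ} (hr : r ≠ 0) (hz : mu M e Λ r = 0) :
    r^2 - 2*M*r + e^2 - (Λ/3)*r^4 = 0 := by
  unfold mu at hz
  field_simp at hz
  linarith

lemma hasDerivAt_mu (M e Λ : ℝ) {r : ℝ} (hr : r ≠ 0) :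
    HasDerivAt (mu M e Λ) (2*M/r^2 - 2*e^2/r^3 - 2*(Λ/3)*r) r := by
  have hinv := (hasDerivAt_id r).fun_inv hr
  have hinv_sq := (hasDerivAt_pow 2 r).fun_inv (pow_ne_zero 2 hr)
  have h := (((hasDerivAt_const r (1 : ℝ)).sub (hinv.const_mul (2*M))).add
    (hinv_sq.const_mul (e^2))).sub ((hasDerivAt_pow 2 r).const_mul (Λ/3))
  refine (h.congr_deriv ?_).congr_of_eventuallyEq (.of_forall fun x => ?_)
  · simp only [id]
    field_simp
    ring
  · simp [mu, div_eq_mul_inv]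

/-- At a zero of `μ`, the charge can be eliminated from the derivative. -/
lemma deriv_mu_of_mu_eq_zero {M e Λ r : ℝ} (hr : r ≠ 0) (hz : mu M e Λ r = 0) :
    deriv (mu M e Λ) r = (2*r - 2*M - 4*(Λ/3)*r^3) / r^2 := by
  rw [(hasDerivAt_mu M e Λ hr).deriv]
  field_simp
  linear_combination (-6) * quartic_eq_zero_of_mu_eq_zero hr hz

/-- For every non-degenerate triple `(M, e, Λ)` (with zeros `0 < r₋ < r₊ < r_c` of `μ`),
the surface gravities of the Cauchy horizon and of the event horizon satisfy `κ₋ > κ₊`. -/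
theorem surface_gravity_ineq (M e Λ rm rp rc : ℝ)
    (hM : 0 < M) (he : 0 < e) (hΛ : 0 < Λ)
    (h₀ : 0 < rm) (h₁ : rm < rp) (h₂ : rp < rc)
    (hzm : mu M e Λ rm = 0) (hzp : mu M e Λ rp = 0) (hzc : mu M e Λ rc = 0) :
    kappaM M e Λ rm > kappaP M e Λ rp := by
  have ha : rm ≠ 0 := h₀.ne'
  have hrp : 0 < rp := h₀.trans h₁
  have hb : rp ≠ 0 := hrp.ne'
  have hc : rc ≠ 0 := (hrp.trans h₂).ne'
  have qa := quartic_eq_zero_of_mu_eq_zero ha hzm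
  have qb := quartic_eq_zero_of_mu_eq_zero hb hzp
  have qc := quartic_eq_zero_of_mu_eq_zero hc hzc
  have hab : (rp + rm) - 2*M - (Λ/3)*(rp + rm)*(rp^2 + rm^2) = 0 := by
    apply mul_left_cancel₀ (sub_ne_zero.2 h₁.ne')
    linear_combination qb - qa
  have hac : (rc + rm) - 2*M - (Λ/3)*(rc + rm)*(rc^2 + rm^2) = 0 := by
    apply mul_left_cancel₀ (sub_ne_zero.2 (h₁.trans h₂).ne')
    linear_combination qc - qa
  have hone : 1 = (Λ/3)*(rm^2 + rp^2 + rc^2 + rm*rp + rp*rc + rc*rm) := by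
    apply mul_left_cancel₀ (sub_ne_zero.2 h₂.ne')
    linear_combination hac - hab
  have hmass : 2*M = (Λ/3)*((rm + rp)*(rp + rc)*(rc + rm)) := by
    linear_combination (rm + rp) * hone - hab
  have hda : 2*rm - 2*M - 4*(Λ/3)*rm^3
      = -((Λ/3)*(rp - rm)*((rc - rm)*(2*rm + rp + rc))) := by
    linear_combination 2*rm*hone - hmass
  have hdb : 2*rp - 2*M - 4*(Λ/3)*rp^3
      = (Λ/3)*(rp - rm)*((rc - rp)*(rm + 2*rp + rc)) := by
    linear_combination 2*rp*hone - hmass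
  have hk : 0 < (Λ/3)*(rp - rm) := mul_pos (by positivity) (sub_pos.2 h₁)
  have hrc : 0 < rc := hrp.trans h₂
  have hcb : 0 < rc - rp := sub_pos.2 h₂
  have hfac : (rm + 2*rp + rc)*rm^2 < (2*rm + rp + rc)*rp^2 := by
    have : 0 < (rp - rm)*(rm^2 + rp^2 + 3*(rm*rp) + rc*(rm + rp)) :=
      mul_pos (sub_pos.2 h₁) (by positivity)
    linarith
  have hprod : (rc - rp)*(rm + 2*rp + rc)*rm^2 < (rc - rm)*(2*rm + rp + rc)*rp^2 := by
    calc (rc - rp)*(rm + 2*rp + rc)*rm^2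
        = (rc - rp)*((rm + 2*rp + rc)*rm^2) := by ring
      _ < (rc - rm)*((2*rm + rp + rc)*rp^2) :=
          mul_lt_mul'' (by linarith) hfac hcb.le (by positivity)
      _ = (rc - rm)*(2*rm + rp + rc)*rp^2 := by ring
  have hdiv : (rc - rp)*(rm + 2*rp + rc)/rp^2 < (rc - rm)*(2*rm + rp + rc)/rm^2 :=
    (div_lt_div_iff₀ (by positivity) (by positivity)).2 hprod
  have hlt := mul_lt_mul_of_pos_left hdiv hk
  rw [kappaM, kappaP, deriv_mu_of_mu_eq_zero ha hzm, deriv_mu_of_mu_eq_zero hb hzp, hda, hdb,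
    neg_div, mul_div_assoc (Λ/3*(rp - rm)), mul_div_assoc (Λ/3*(rp - rm))]
  linarith
end
end

section
/- There exist functions Ĥ_in, Ĥ_out : 𝒰 × (r₋, r_c) → ℂ such that: (i) for every ω ∈ 𝒰, the maps r ↦ Ĥ_in(ω,r) and r ↦ Ĥ_out(ω,r) are real-analytic on (r₋, r_c) and satisfy Ĥ_in(ω, r₊) = Ĥ_out(ω, r₊) = 1; (ii) for every fixed r ∈ (r₋, r_c), the maps ω ↦ Ĥ_in(ω,r) and ω ↦ Ĥ_out(ω,r) are holomorphic on 𝒰; (iii) for every ω ∈ 𝒰, the functions R_in(ω,r) := |r − r₊|^(−iω/(2κ₊))·Ĥ_in(ω,r) and R_out(ω,r) := |r − r₊|^(iω/(2κ₊))·Ĥ_out(ω,r) solve the radial o.d.e. with frequency ω on each of the intervals (r₋, r₊) and (r₊, r_c). -/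
noncomputable section

/-- Surface gravity of the cosmological horizon: `κ_c = -(1/2)·μ′(r_c)`. -/
def kappaC (M e Λ rc : ℝ) : ℝ := -(1/2) * deriv (mu M e Λ) rc

/-- A twice-differentiable `R : I → ℂ` solves the radial o.d.e. with frequency `ω`:
`r⁻²·μ(r)·(d/dr)(r²·μ(r)·R′(r)) + ω²·R(r) = 0` for all `r ∈ I`. -/
def SolvesODE (M e Λ : ℝ) (ω : ℂ) (I : Set ℝ) (R : ℝ → ℂ) : Prop :=
  (∀ r ∈ I, DifferentiableAt ℝ R r) ∧
  (∀ r ∈ I, DifferentiableAt ℝ (deriv R) r) ∧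
  ∀ r ∈ I, ((r:ℂ)^2)⁻¹ * (mu M e Λ r : ℂ) *
      deriv (fun s : ℝ => (s:ℂ)^2 * (mu M e Λ s : ℂ) * deriv R s) r
    + ω^2 * R r = 0

/-- The set `𝒰` of `ω ∈ ℂ` not of the form `i·κ·n` with `κ ∈ {κ₊, κ₋, κ_c}` and
`n` a nonzero integer. -/
def calU (kp km kc : ℝ) : Set ℂ :=
  {ω : ℂ | ∀ κ ∈ ({kp, km, kc} : Set ℝ), ∀ n : ℤ, n ≠ 0 → ω ≠ Complex.I * κ * n}


/-! ### Power series converging on the unit disc -/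

lemma pow_mul_div_pow {r s : ℝ} (hs : s ≠ 0) (n : ℕ) : s ^ n * (r / s) ^ n = r ^ n := by
  rw [← mul_pow, mul_div_cancel₀ r hs]

/-- The power series with coefficients `c` converges absolutely on the open unit disc. -/
def DiscSummable (c : ℕ → ℂ) : Prop :=
  ∀ r : ℝ, 0 ≤ r → r < 1 → Summable fun n => ‖c n‖ * r ^ n

/-- The sum of the power series with coefficients `c`. -/
def powerSum (c : ℕ → ℂ) (z : ℂ) : ℂ := ∑' n, c n * z ^ n

lemma hasSum_of_forall_eq {f g : ℕ → ℂ} {s : ℂ} (h : ∀ n, f n = g n) (hg : HasSum g s) :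
    HasSum f s := by
  rwa [funext h]

lemma DiscSummable.of_bound {c : ℕ → ℂ}
    (h : ∀ r : ℝ, 0 < r → r < 1 → ∃ K, ∀ n, ‖c n‖ * r ^ n ≤ K) : DiscSummable c := by
  intro r hr0 hr1
  obtain ⟨K, hK⟩ := h ((1 + r) / 2) (by linarith) (by linarith)
  have hp : 0 < (1 + r) / 2 := by linarith
  refine Summable.of_nonneg_of_le (fun n => by positivity) (fun n => ?_)
    ((summable_geometric_of_lt_one (r := r / ((1 + r) / 2)) (by positivity)
      (by rw [div_lt_one hp]; linarith)).mul_left K)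
  calc ‖c n‖ * r ^ n = (‖c n‖ * ((1 + r) / 2) ^ n) * (r / ((1 + r) / 2)) ^ n := by
        rw [mul_assoc, pow_mul_div_pow hp.ne']
    _ ≤ _ := by gcongr; exact hK n

lemma DiscSummable.exists_bound {c : ℕ → ℂ} (h : DiscSummable c) {r : ℝ} (hr0 : 0 ≤ r)
    (hr1 : r < 1) : ∃ K, 0 < K ∧ ∀ n, ‖c n‖ * r ^ n ≤ K := by
  refine ⟨∑' n, ‖c n‖ * r ^ n + 1, ?_, fun n => ?_⟩
  · have : 0 ≤ ∑' n, ‖c n‖ * r ^ n := tsum_nonneg fun n => by positivity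
    linarith
  · have := (h r hr0 hr1).le_tsum n (fun j _ => by positivity)
    linarith

lemma DiscSummable.summable_norm {c : ℕ → ℂ} (h : DiscSummable c) {z : ℂ} (hz : ‖z‖ < 1) :
    Summable fun n => ‖c n * z ^ n‖ := by
  simpa using h ‖z‖ (norm_nonneg z) hz

lemma DiscSummable.hasSum {c : ℕ → ℂ} (h : DiscSummable c) {z : ℂ} (hz : ‖z‖ < 1) :
    HasSum (fun n => c n * z ^ n) (powerSum c z) :=
  (h.summable_norm hz).of_norm.hasSum

lemma DiscSummable.nat_mul {c : ℕ → ℂ} (h : DiscSummable c) :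
    DiscSummable fun n => n * c n := by
  refine .of_bound fun r hr0 hr1 => ?_
  have hp : 0 < (1 + r) / 2 := by linarith
  obtain ⟨K, hK0, hK⟩ := h.exists_bound hp.le (by linarith)
  have hs := summable_pow_mul_geometric_of_norm_lt_one 1 (r := r / ((1 + r) / 2)) (by
    rw [Real.norm_of_nonneg (by positivity), div_lt_one hp]; linarith)
  refine ⟨K * ∑' n : ℕ, (n : ℝ) ^ 1 * (r / ((1 + r) / 2)) ^ n, fun n => ?_⟩
  calc ‖(n : ℂ) * c n‖ * r ^ n
      = (‖c n‖ * ((1 + r) / 2) ^ n) * ((n : ℝ) ^ 1 * (r / ((1 + r) / 2)) ^ n) := by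
        rw [norm_mul, Complex.norm_natCast, ← pow_mul_div_pow hp.ne' n]; ring
    _ ≤ K * ((n : ℝ) ^ 1 * (r / ((1 + r) / 2)) ^ n) := by gcongr; exact hK n
    _ ≤ _ := by gcongr; exact hs.le_tsum n fun j _ => by positivity

lemma DiscSummable.differentiableOn {c : ℕ → ℂ} (h : DiscSummable c) :
    DifferentiableOn ℂ (powerSum c) (Metric.ball 0 1) := by
  intro z hz
  obtain ⟨r, hzr, hr1⟩ := exists_between (mem_ball_zero_iff.1 hz)
  have hr0 : 0 ≤ r := (norm_nonneg z).trans hzr.le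
  refine DifferentiableAt.differentiableWithinAt ?_
  refine DifferentiableOn.differentiableAt (s := Metric.ball 0 r) ?_
    (Metric.isOpen_ball.mem_nhds (by simpa using hzr))
  refine Complex.differentiableOn_tsum_of_summable_norm (h r hr0 hr1)
    (fun n => by fun_prop) Metric.isOpen_ball fun n w hw => ?_
  rw [norm_mul, norm_pow]
  gcongr
  exact (mem_ball_zero_iff.1 hw).le

lemma DiscSummable.mul_deriv {c : ℕ → ℂ} (h : DiscSummable c) {z : ℂ} (hz : ‖z‖ < 1) :
    z * deriv (powerSum c) z = powerSum (fun n => n * c n) z := by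
  obtain ⟨r, hzr, hr1⟩ := exists_between hz
  have hr0 : 0 ≤ r := (norm_nonneg z).trans hzr.le
  have hs := Complex.hasSum_deriv_of_summable_norm (U := Metric.ball 0 r) (F := fun n w => c n * w ^ n) (h r hr0 hr1)
    (fun n => by fun_prop) (Metric.isOpen_ball (α := ℂ) (x := 0) (ε := r)) (fun n w hw => by
      rw [norm_mul, norm_pow]
      gcongr
      exact (mem_ball_zero_iff.1 hw).le) (by simpa using hzr)
  refine (hs.mul_left z).unique ?_
  refine hasSum_of_forall_eq (fun n => ?_) (h.nat_mul.hasSum hz)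
  rcases n with _ | n
  · simp
  · simp only [deriv_const_mul_field, deriv_pow_field, Nat.add_sub_cancel]
    ring

lemma DiscSummable.hasSum_mul {p c : ℕ → ℂ} (hp : DiscSummable p) (hc : DiscSummable c) {z : ℂ}
    (hz : ‖z‖ < 1) :
    HasSum (fun n => (∑ k ∈ Finset.range (n + 1), p (n - k) * c k) * z ^ n)
      (powerSum p z * powerSum c z) := by
  have h₁ := hc.summable_norm hz
  have h₂ := hp.summable_norm hz
  have hs := (summable_norm_sum_mul_antidiagonal_of_summable_norm h₁ h₂).of_norm.hasSum
  rw [← tsum_mul_tsum_eq_tsum_sum_antidiagonal_of_summable_norm h₁ h₂, mul_comm] at hs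
  refine hasSum_of_forall_eq (fun n => ?_) hs
  rw [Finset.Nat.sum_antidiagonal_eq_sum_range_succ_mk, Finset.sum_mul]
  refine Finset.sum_congr rfl fun k hk => ?_
  have : n = k + (n - k) := by have := Finset.mem_range.1 hk; omega
  conv_lhs => rw [this, pow_add]
  simp only [add_tsub_cancel_left]
  ring

lemma exists_powerSum_eq {f : ℂ → ℂ} (hf : DifferentiableOn ℂ f (Metric.ball 0 1)) :
    ∃ c, DiscSummable c ∧ c 0 = f 0 ∧ ∀ z, ‖z‖ < 1 → powerSum c z = f z := by
  have hs : ∀ z : ℂ, ‖z‖ < 1 →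
      HasSum (fun n : ℕ => ((n.factorial : ℂ)⁻¹ * iteratedDeriv n f 0) * z ^ n) (f z) := by
    intro z hz
    refine hasSum_of_forall_eq (fun n => ?_)
      (Complex.hasSum_taylorSeries_on_ball hf (mem_ball_zero_iff.2 hz))
    simp only [sub_zero, smul_eq_mul]; ring
  refine ⟨fun n => (n.factorial : ℂ)⁻¹ * iteratedDeriv n f 0, fun r hr0 hr1 => ?_, by simp,
    fun z hz => (hs z hz).tsum_eq⟩
  have := (hs r (by simpa [abs_of_nonneg hr0] using hr1)).summable.norm
  simpa [abs_of_nonneg hr0] using this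

/-! ### Frobenius series at a regular singular point -/

/-- Coefficients of the Frobenius solution of `(θ + a)² H + f (θ + a) H = a² g H`, `θ = z d/dz`,
where `f` and `g` have Taylor coefficients `p` and `q` with `p 0 = 0` and `q 0 = 1`. -/
def frobeniusCoeff (p q : ℕ → ℂ) (a : ℂ) : ℕ → ℂ
  | 0 => 1
  | n + 1 => -(∑ k : Fin (n + 1), (p (n + 1 - k) * (a + (k : ℕ)) - a ^ 2 * q (n + 1 - k)) *
      frobeniusCoeff p q a k) / ((n + 1) * (n + 1 + 2 * a))
decreasing_by exact k.2

lemma frobeniusCoeff_zero (p q : ℕ → ℂ) (a : ℂ) : frobeniusCoeff p q a 0 = 1 := by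
  rw [frobeniusCoeff]

lemma frobeniusCoeff_succ (p q : ℕ → ℂ) (a : ℂ) (n : ℕ) :
    frobeniusCoeff p q a (n + 1) = -(∑ k ∈ Finset.range (n + 1),
      (p (n + 1 - k) * (a + k) - a ^ 2 * q (n + 1 - k)) * frobeniusCoeff p q a k) /
        ((n + 1) * (n + 1 + 2 * a)) := by
  rw [frobeniusCoeff, ← Fin.sum_univ_eq_sum_range (fun k => (p (n + 1 - k) * (a + k) -
    a ^ 2 * q (n + 1 - k)) * frobeniusCoeff p q a k)]

/-- Exponents `a` for which the second indicial root `-2a` of the Frobenius recursion is not a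
positive integer. -/
def nonresonant : Set ℂ := {a | ∀ n : ℕ, (n : ℂ) + 1 + 2 * a ≠ 0}

lemma differentiableOn_frobeniusCoeff (p q : ℕ → ℂ) (n : ℕ) :
    DifferentiableOn ℂ (fun a => frobeniusCoeff p q a n) nonresonant := by
  induction n using Nat.strong_induction_on with
  | _ n ih =>
    rcases n with _ | n
    · simp only [frobeniusCoeff_zero]; fun_prop
    · simp only [frobeniusCoeff_succ]
      refine DifferentiableOn.div (DifferentiableOn.neg (DifferentiableOn.fun_sum fun k hk => ?_))
        (by fun_prop) fun a ha => mul_ne_zero (by exact_mod_cast n.succ_ne_zero) (ha n)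
      exact DifferentiableOn.mul (by fun_prop) (ih k (Finset.mem_range.1 hk))

lemma exists_uniform_nonresonant {a₀ : ℂ} (h : a₀ ∈ nonresonant) :
    ∃ δ : ℝ, 0 < δ ∧ ∀ a ∈ Metric.ball a₀ δ, ∀ n : ℕ,
      δ * (n + 1) ≤ ‖(n : ℂ) + 1 + 2 * a‖ := by
  have ht : Filter.Tendsto (fun n : ℕ => ‖(1 + 2 * a₀ * (1 / ((n : ℂ) + 1)))⁻¹‖) Filter.atTop
      (nhds ‖(1 + 2 * a₀ * 0 : ℂ)⁻¹‖) := by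
    refine (Filter.Tendsto.inv₀ ?_ (by simp)).norm
    exact (tendsto_one_div_add_atTop_nhds_zero_nat.const_mul _).const_add _
  obtain ⟨C, hC⟩ := ht.bddAbove_range
  have hC' : ∀ n : ℕ, ‖(1 + 2 * a₀ * (1 / ((n : ℂ) + 1)))⁻¹‖ ≤ C := fun n => hC ⟨n, rfl⟩
  have hlow : ∀ n : ℕ, ((n : ℝ) + 1) ≤ C * ‖(n : ℂ) + 1 + 2 * a₀‖ := by
    intro n
    have hn : (n : ℂ) + 1 ≠ 0 := by exact_mod_cast n.succ_ne_zero
    have h1 : (1 + 2 * a₀ * (1 / ((n : ℂ) + 1)))⁻¹ = ((n : ℂ) + 1) / ((n : ℂ) + 1 + 2 * a₀) := by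
      rw [eq_div_iff (h n), inv_mul_eq_div, div_eq_iff]
      · field_simp
      · intro h0
        apply h n
        field_simp at h0
        linear_combination h0
    have h2 := hC' n
    have h3 : ‖(n : ℂ) + 1‖ = (n : ℝ) + 1 := by exact_mod_cast Complex.norm_natCast (n + 1)
    rw [h1, norm_div, h3, div_le_iff₀ (norm_pos_iff.2 (h n))] at h2
    exact h2
  have hC0 : 0 < C := by
    have := hlow 0
    by_contra! hc
    have := mul_nonpos_of_nonpos_of_nonneg hc (norm_nonneg (((0 : ℕ) : ℂ) + 1 + 2 * a₀))
    push_cast at *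
    linarith
  refine ⟨1 / (3 * C), by positivity, fun a ha n => ?_⟩
  have h1 : ‖(n : ℂ) + 1 + 2 * a₀‖ ≤ ‖(n : ℂ) + 1 + 2 * a‖ + 2 * ‖a - a₀‖ := by
    have : (n : ℂ) + 1 + 2 * a₀ = ((n : ℂ) + 1 + 2 * a) - 2 * (a - a₀) := by ring
    rw [this]
    refine (norm_sub_le _ _).trans (le_of_eq ?_)
    simp
  have h2 : ‖a - a₀‖ < 1 / (3 * C) := by simpa [dist_eq_norm] using ha
  have h3 : ((n : ℝ) + 1) / C ≤ ‖(n : ℂ) + 1 + 2 * a₀‖ := by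
    rw [div_le_iff₀ hC0, mul_comm]; exact hlow n
  have h4 : 1 / (3 * C) ≤ 1 / (3 * C) * ((n : ℝ) + 1) :=
    le_mul_of_one_le_right (by positivity) (by linarith [n.cast_nonneg (α := ℝ)])
  have h5 : ((n : ℝ) + 1) / C = 3 * (1 / (3 * C) * ((n : ℝ) + 1)) := by field_simp
  linarith

lemma le_pow_of_recursive_bound {u : ℕ → ℝ} {B : ℝ} (hB : 0 ≤ B) {N : ℕ} (hN : B ≤ N)
    (h0 : u 0 ≤ 1)
    (h : ∀ n : ℕ, ∀ m : ℝ, 0 ≤ m → (∀ k ≤ n, u k ≤ m) → u (n + 1) ≤ B / (n + 1) * m) (n : ℕ) :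
    u n ≤ (1 + B) ^ N := by
  suffices H : ∀ n, u n ≤ (1 + B) ^ min n N from
    (H n).trans (pow_le_pow_right₀ (by linarith) (min_le_right n N))
  intro n
  induction n using Nat.strong_induction_on with
  | _ n ih =>
    rcases n with _ | n
    · simpa using h0
    · have hm : ∀ k ≤ n, u k ≤ (1 + B) ^ min n N := fun k hk =>
        (ih k (by omega)).trans (pow_le_pow_right₀ (by linarith) (by omega))
      refine (h n _ (by positivity) hm).trans ?_
      rcases lt_or_ge n N with hn | hn
      · rw [min_eq_left hn.le, min_eq_left (by omega), pow_succ, mul_comm]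
        gcongr
        rw [div_le_iff₀ (by positivity)]
        nlinarith [n.cast_nonneg (α := ℝ)]
      · rw [min_eq_right hn, min_eq_right (by omega)]
        refine mul_le_of_le_one_left (by positivity) ?_
        rw [div_le_one (by positivity)]
        have : (N : ℝ) ≤ n := by exact_mod_cast hn
        linarith

lemma exists_uniform_bound_frobeniusCoeff {p q : ℕ → ℂ} (hp : DiscSummable p)
    (hq : DiscSummable q) {a₀ : ℂ} (h : a₀ ∈ nonresonant) :
    ∃ δ : ℝ, 0 < δ ∧ Metric.ball a₀ δ ⊆ nonresonant ∧ ∀ r : ℝ, 0 < r → r < 1 →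
      ∃ K, ∀ a ∈ Metric.ball a₀ δ, ∀ n, ‖frobeniusCoeff p q a n‖ * r ^ n ≤ K := by
  obtain ⟨δ, hδ, hlow⟩ := exists_uniform_nonresonant h
  refine ⟨δ, hδ, fun a ha n h0 => ?_, fun r hr0 hr1 => ?_⟩
  · have := hlow a ha n
    rw [h0, norm_zero] at this
    have : 0 < δ * ((n : ℝ) + 1) := by positivity
    linarith
  set ρ := (1 + r) / 2 with hρ
  have hρ0 : 0 < ρ := by rw [hρ]; linarith
  have hrρ : r / ρ < 1 := by rw [div_lt_one hρ0, hρ]; linarith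
  have ht : 0 < 1 - r / ρ := by linarith
  obtain ⟨C₁, hC₁, hpC⟩ := hp.exists_bound hρ0.le (by rw [hρ]; linarith)
  obtain ⟨C₂, hC₂, hqC⟩ := hq.exists_bound hρ0.le (by rw [hρ]; linarith)
  set A := ‖a₀‖ + δ with hA
  have hA0 : 0 ≤ A := by positivity
  set D := C₁ * (A + 1) + A ^ 2 * C₂ with hD
  have hD0 : 0 ≤ D := by positivity
  set B := D / δ * (1 - r / ρ)⁻¹ with hBdef
  have hB : 0 ≤ B := by positivity
  obtain ⟨N, hN⟩ := exists_nat_ge B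
  refine ⟨(1 + B) ^ N, fun a ha n => ?_⟩
  refine le_pow_of_recursive_bound (u := fun n => ‖frobeniusCoeff p q a n‖ * r ^ n) hB hN
    (by simp [frobeniusCoeff_zero]) (fun n m hm0 hm => ?_) n
  have haA : ‖a‖ ≤ A := by
    have h1 : ‖a - a₀‖ < δ := by simpa [dist_eq_norm] using ha
    have h2 := norm_add_le (a - a₀) a₀
    rw [sub_add_cancel] at h2
    linarith
  have hn : ‖(n : ℂ) + 1‖ = (n : ℝ) + 1 := by exact_mod_cast Complex.norm_natCast (n + 1)
  have hterm : ∀ k ∈ Finset.range (n + 1),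
      ‖(p (n + 1 - k) * (a + k) - a ^ 2 * q (n + 1 - k)) * frobeniusCoeff p q a k‖ * r ^ (n + 1)
        ≤ D * (n + 1) * m * (r / ρ) ^ (n + 1 - k) := by
    intro k hk
    have hk' : k ≤ n := Nat.lt_succ_iff.1 (Finset.mem_range.1 hk)
    set j := n + 1 - k with hj
    have hpow : r ^ (n + 1) = ρ ^ j * (r / ρ) ^ j * r ^ k := by
      rw [pow_mul_div_pow hρ0.ne', ← pow_add]
      congr 1; omega
    have hc : ‖p j * (a + k) - a ^ 2 * q j‖ * ρ ^ j ≤ D * (n + 1) := by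
      have h1 : ‖p j * (a + k) - a ^ 2 * q j‖ ≤ ‖p j‖ * (A + n) + A ^ 2 * ‖q j‖ := by
        refine (norm_sub_le _ _).trans ?_
        rw [norm_mul, norm_mul, norm_pow]
        gcongr
        refine (norm_add_le _ _).trans ?_
        rw [Complex.norm_natCast]
        have : (k : ℝ) ≤ n := by exact_mod_cast hk'
        linarith
      have hn0 : (0 : ℝ) ≤ n := n.cast_nonneg
      calc ‖p j * (a + k) - a ^ 2 * q j‖ * ρ ^ j
          ≤ (‖p j‖ * (A + n) + A ^ 2 * ‖q j‖) * ρ ^ j := by gcongr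
        _ = (‖p j‖ * ρ ^ j) * (A + n) + A ^ 2 * (‖q j‖ * ρ ^ j) := by ring
        _ ≤ C₁ * (A + n) + A ^ 2 * C₂ := by
          gcongr
          · exact hpC j
          · exact hqC j
        _ ≤ D * (n + 1) := by
          rw [hD]
          have : 0 ≤ A ^ 2 * C₂ * n := by positivity
          have : 0 ≤ C₁ * A * n := by positivity
          nlinarith
    calc _ = (‖p j * (a + k) - a ^ 2 * q j‖ * ρ ^ j) * (‖frobeniusCoeff p q a k‖ * r ^ k) *
          (r / ρ) ^ j := by rw [norm_mul, hpow]; ring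
      _ ≤ (D * (n + 1)) * m * (r / ρ) ^ j := by
        gcongr
        exact hm k hk'
  have hgeom : ∑ k ∈ Finset.range (n + 1), (r / ρ) ^ (n + 1 - k) ≤ (1 - r / ρ)⁻¹ := by
    have h1 : ∑ k ∈ Finset.range (n + 1), (r / ρ) ^ (n + 1 - k)
        = ∑ k ∈ Finset.range (n + 1), (r / ρ) ^ (k + 1) := by
      rw [← Finset.sum_range_reflect]
      refine Finset.sum_congr rfl fun k hk => ?_
      have := Finset.mem_range.1 hk
      congr 1; omega
    rw [h1, ← tsum_geometric_of_lt_one (by positivity) hrρ]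
    have hs := summable_geometric_of_lt_one (r := r / ρ) (by positivity) hrρ
    refine le_trans ?_ (hs.sum_le_tsum (Finset.range (n + 2)) fun _ _ => by positivity)
    rw [Finset.sum_range_succ' _ (n + 1)]
    simp
  have hden : 0 < δ * ((n : ℝ) + 1) := by positivity
  calc ‖frobeniusCoeff p q a (n + 1)‖ * r ^ (n + 1)
      = ‖∑ k ∈ Finset.range (n + 1), (p (n + 1 - k) * (a + k) - a ^ 2 * q (n + 1 - k)) *
          frobeniusCoeff p q a k‖ * r ^ (n + 1) / (((n : ℝ) + 1) * ‖(n : ℂ) + 1 + 2 * a‖) := by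
        rw [frobeniusCoeff_succ, norm_div, norm_neg, norm_mul, hn]; ring
    _ ≤ (∑ k ∈ Finset.range (n + 1), D * (n + 1) * m * (r / ρ) ^ (n + 1 - k)) /
          (((n : ℝ) + 1) * (δ * ((n : ℝ) + 1))) := by
        gcongr
        · refine (mul_le_mul_of_nonneg_right (norm_sum_le _ _) (by positivity)).trans ?_
          rw [Finset.sum_mul]
          exact Finset.sum_le_sum hterm
        · exact hlow a ha n
    _ ≤ (D * (n + 1) * m * (1 - r / ρ)⁻¹) / (((n : ℝ) + 1) * (δ * ((n : ℝ) + 1))) := by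
        rw [← Finset.mul_sum]
        gcongr
    _ = B / (n + 1) * m := by rw [hBdef]; field_simp

/-- Frobenius' theorem for `(θ + a)² H + f (θ + a) H = a² g H` on the unit disc, with holomorphic
dependence on the exponent `a`. -/
theorem exists_frobenius_solution {f g : ℂ → ℂ} (hf : DifferentiableOn ℂ f (Metric.ball 0 1))
    (hg : DifferentiableOn ℂ g (Metric.ball 0 1)) (hf0 : f 0 = 0) (hg0 : g 0 = 1) :
    ∃ H : ℂ → ℂ → ℂ,
      (∀ z : ℂ, ‖z‖ < 1 → DifferentiableOn ℂ (fun a => H a z) nonresonant) ∧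
      ∀ a ∈ nonresonant, DifferentiableOn ℂ (H a) (Metric.ball 0 1) ∧ H a 0 = 1 ∧
        ∀ z : ℂ, ‖z‖ < 1 →
          a * (a * H a z + z * deriv (H a) z)
            + z * deriv (fun w => a * H a w + w * deriv (H a) w) z
            + f z * (a * H a z + z * deriv (H a) z) = a ^ 2 * g z * H a z := by
  obtain ⟨p, hp, hp0, hpf⟩ := exists_powerSum_eq hf
  obtain ⟨q, hq, hq0, hqg⟩ := exists_powerSum_eq hg
  rw [hf0] at hp0
  rw [hg0] at hq0
  refine ⟨fun a => powerSum (frobeniusCoeff p q a), fun z hz => ?_, fun a ha => ?_⟩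
  · intro a₀ ha₀
    obtain ⟨δ, hδ, hsub, hb⟩ := exists_uniform_bound_frobeniusCoeff hp hq ha₀
    refine DifferentiableAt.differentiableWithinAt ?_
    refine DifferentiableOn.differentiableAt (s := Metric.ball a₀ δ) ?_
      (Metric.ball_mem_nhds a₀ hδ)
    obtain ⟨r, hzr, hr1⟩ := exists_between hz
    have hr0 : 0 < r := (norm_nonneg z).trans_lt hzr
    obtain ⟨K, hK⟩ := hb r hr0 hr1
    refine Complex.differentiableOn_tsum_of_summable_norm (u := fun n => K * (‖z‖ / r) ^ n)
      ((summable_geometric_of_lt_one (by positivity) ((div_lt_one hr0).2 hzr)).mul_left K)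
      (fun n => ((differentiableOn_frobeniusCoeff p q n).mono hsub).mul_const _)
      Metric.isOpen_ball fun n a ha => ?_
    calc ‖frobeniusCoeff p q a n * z ^ n‖
        = (‖frobeniusCoeff p q a n‖ * r ^ n) * (‖z‖ / r) ^ n := by
          rw [norm_mul, norm_pow, div_pow]; field_simp
      _ ≤ _ := by gcongr; exact hK a ha n
  · obtain ⟨δ, hδ, hsub, hb⟩ := exists_uniform_bound_frobeniusCoeff hp hq ha
    set h := frobeniusCoeff p q a with hdef
    have hh : DiscSummable h := .of_bound fun r hr0 hr1 => by
      obtain ⟨K, hK⟩ := hb r hr0 hr1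
      exact ⟨K, hK a (Metric.mem_ball_self hδ)⟩
    have hc : DiscSummable fun n => (a + n) * h n := by
      intro r hr0 hr1
      refine Summable.of_nonneg_of_le (fun n => by positivity) (fun n => ?_)
        (((hh r hr0 hr1).mul_left ‖a‖).add (hh.nat_mul r hr0 hr1))
      rw [← mul_assoc, ← add_mul, ← norm_mul]
      refine mul_le_mul_of_nonneg_right ?_ (by positivity)
      simp only [add_mul]
      exact norm_add_le _ _
    have hθ : ∀ (c : ℕ → ℂ), DiscSummable c → ∀ z : ℂ, ‖z‖ < 1 →
        HasSum (fun n => (a + n) * c n * z ^ n) (a * powerSum c z + z * deriv (powerSum c) z) := by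
      intro c hc z hz
      rw [hc.mul_deriv hz]
      refine hasSum_of_forall_eq (fun n => ?_)
        (((hc.hasSum hz).mul_left a).add (hc.nat_mul.hasSum hz))
      ring
    refine ⟨hh.differentiableOn, ?_, fun z hz => ?_⟩
    · refine (tsum_eq_single 0 fun n hn => by simp [hn]).trans ?_
      simp [frobeniusCoeff_zero]
    · have h₁ : ∀ w : ℂ, ‖w‖ < 1 → a * powerSum h w + w * deriv (powerSum h) w
          = powerSum (fun n => (a + n) * h n) w := fun w hw => (hθ h hh w hw).unique (hc.hasSum hw)
      have h₂ : deriv (fun w => a * powerSum h w + w * deriv (powerSum h) w) z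
          = deriv (powerSum fun n => (a + n) * h n) z := by
        refine Filter.EventuallyEq.deriv_eq ?_
        filter_upwards [Metric.isOpen_ball.mem_nhds (mem_ball_zero_iff.2 hz)] with w hw
        exact h₁ w (mem_ball_zero_iff.1 hw)
      rw [h₂, h₁ z hz, ← hpf z hz, ← hqg z hz, mul_assoc, ← sub_eq_zero]
      refine (((hθ _ hc z hz).add (hp.hasSum_mul hc hz)).sub
        ((hq.hasSum_mul hh hz).mul_left (a ^ 2))).unique ?_
      refine hasSum_of_forall_eq (fun n => ?_) hasSum_zero
      rcases n with _ | n
      · simp [hp0, hq0, hdef, frobeniusCoeff_zero]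
        ring
      · rw [Finset.sum_range_succ, Finset.sum_range_succ (fun k => q (n + 1 - k) * h k), Nat.sub_self,
          hp0, hq0]
        have hrec := frobeniusCoeff_succ p q a n
        rw [eq_div_iff (mul_ne_zero (by exact_mod_cast n.succ_ne_zero) (ha n)), ← hdef] at hrec
        have hsplit : ∑ k ∈ Finset.range (n + 1),
              (p (n + 1 - k) * (a + k) - a ^ 2 * q (n + 1 - k)) * h k
            = ∑ k ∈ Finset.range (n + 1), p (n + 1 - k) * ((a + k) * h k)
              - a ^ 2 * ∑ k ∈ Finset.range (n + 1), q (n + 1 - k) * h k := by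
          rw [Finset.mul_sum, ← Finset.sum_sub_distrib]
          exact Finset.sum_congr rfl fun k _ => by ring
        rw [hsplit] at hrec
        push_cast
        linear_combination z ^ (n + 1) * hrec

/-- Frobenius' theorem for `(V (θ + a))² H = c² a² ρ⁴ H` on the unit disc, `θ = z d/dz`, with
holomorphic dependence on the exponent `a`. -/
theorem exists_frobenius_solution_sq {V ρ : ℂ → ℂ} {c : ℂ}
    (hV : DifferentiableOn ℂ V (Metric.ball 0 1)) (hV0 : ∀ z : ℂ, ‖z‖ < 1 → V z ≠ 0)
    (hρ : DifferentiableOn ℂ ρ (Metric.ball 0 1)) (hc : V 0 = c * ρ 0 ^ 2) :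
    ∃ H : ℂ → ℂ → ℂ,
      (∀ z : ℂ, ‖z‖ < 1 → DifferentiableOn ℂ (fun a => H a z) nonresonant) ∧
      ∀ a ∈ nonresonant, DifferentiableOn ℂ (H a) (Metric.ball 0 1) ∧ H a 0 = 1 ∧
        ∃ K : ℂ → ℂ, DifferentiableOn ℂ K (Metric.ball 0 1) ∧ ∀ z : ℂ, ‖z‖ < 1 →
          K z = V z * (a * H a z + z * deriv (H a) z) ∧
          V z * (a * K z + z * deriv K z) = c ^ 2 * a ^ 2 * ρ z ^ 4 * H a z := by
  have hV' : DifferentiableOn ℂ (deriv V) (Metric.ball 0 1) := hV.deriv Metric.isOpen_ball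
  have hne : ∀ z ∈ Metric.ball (0 : ℂ) 1, V z ≠ 0 := fun z hz => hV0 z (mem_ball_zero_iff.1 hz)
  obtain ⟨H, hH, hsol⟩ := exists_frobenius_solution (f := fun z => z * deriv V z / V z)
    (g := fun z => c ^ 2 * ρ z ^ 4 / V z ^ 2)
    ((differentiableOn_id.mul hV').div hV hne)
    (((hρ.pow 4).const_mul _).div (hV.pow 2) fun z hz => pow_ne_zero 2 (hne z hz))
    (by simp) (by
      have h0 := hV0 0 (by simp)
      rw [div_eq_one_iff_eq (pow_ne_zero 2 h0), hc]; ring)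
  refine ⟨H, hH, fun a ha => ?_⟩
  obtain ⟨hd, h1, heq⟩ := hsol a ha
  have hd' : DifferentiableOn ℂ (deriv (H a)) (Metric.ball 0 1) := hd.deriv Metric.isOpen_ball
  have hT : DifferentiableOn ℂ (fun w => a * H a w + w * deriv (H a) w) (Metric.ball 0 1) :=
    (hd.const_mul a).add (differentiableOn_id.mul hd')
  refine ⟨hd, h1, fun w => V w * (a * H a w + w * deriv (H a) w), hV.mul hT,
    fun z hz => ⟨rfl, ?_⟩⟩
  have hn := Metric.isOpen_ball.mem_nhds (mem_ball_zero_iff.2 hz)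
  have hVz := hV0 z hz
  rw [deriv_fun_mul (hV.differentiableAt hn) (hT.differentiableAt hn)]
  have := heq z hz
  field_simp at this
  linear_combination this

/-! ### Passing to the radial variable -/

lemma abs_cpow_eq_exp {t : ℝ} (ht : t ≠ 0) (a : ℂ) :
    ((|t| : ℝ) : ℂ) ^ a = Complex.exp (a * (Real.log t : ℝ)) := by
  rw [Complex.cpow_def_of_ne_zero (by simpa using ht), ← Complex.ofReal_log (abs_nonneg t),
    Real.log_abs, mul_comm]

lemma hasDerivAt_abs_cpow_mul {ζ : ℝ → ℝ} {ζ' r : ℝ} (hζ : HasDerivAt ζ ζ' r) (h0 : ζ r ≠ 0)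
    (a : ℂ) {F : ℂ → ℂ} (hF : DifferentiableAt ℂ F (ζ r)) :
    HasDerivAt (fun s => ((|ζ s| : ℝ) : ℂ) ^ a * F (ζ s))
      (((|ζ r| : ℝ) : ℂ) ^ a * (a * F (ζ r) + ζ r * deriv F (ζ r)) * ((ζ' / ζ r : ℝ) : ℂ)) r := by
  have h1 : HasDerivAt (fun s => Complex.exp (a * (Real.log (ζ s) : ℝ)))
      (Complex.exp (a * (Real.log (ζ r) : ℝ)) * (a * ((ζ' / ζ r : ℝ) : ℂ))) r :=
    ((hζ.log h0).ofReal_comp.const_mul a).cexp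
  have h2 : HasDerivAt (fun s => F (ζ s)) (deriv F (ζ r) * (ζ' : ℂ)) r :=
    hF.hasDerivAt.comp r hζ.ofReal_comp
  refine ((h1.mul h2).congr_of_eventuallyEq ?_).congr_deriv ?_
  · filter_upwards [hζ.continuousAt.eventually_ne h0] with s hs
    simp only [Pi.mul_apply, abs_cpow_eq_exp hs]
  · have h0' : (ζ r : ℂ) ≠ 0 := by exact_mod_cast h0
    rw [abs_cpow_eq_exp h0]
    push_cast
    field_simp

lemma differentiableAt_mu (M e Λ : ℝ) {r : ℝ} (hr : r ≠ 0) : DifferentiableAt ℝ (mu M e Λ) r := by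
  unfold mu
  fun_prop (disch := positivity)

/-- A function `|ζ|ᵃ H(ζ)`, where `H` solves the Frobenius form of the equation in the
variable `ζ`, solves the radial equation. -/
lemma solvesODE_of_frobenius {M e Λ : ℝ} {ω a C c : ℂ} {I : Set ℝ} (hI : IsOpen I)
    {ζ ζ' : ℝ → ℝ} {V ρ H K : ℂ → ℂ} {R : ℝ → ℂ}
    (hr : ∀ r ∈ I, r ≠ 0) (hζ : ∀ r ∈ I, HasDerivAt ζ (ζ' r) r)
    (hζ0 : ∀ r ∈ I, ζ r ≠ 0) (hζ1 : ∀ r ∈ I, |ζ r| < 1)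
    (hV0 : ∀ z : ℂ, ‖z‖ < 1 → V z ≠ 0)
    (hPV : ∀ r ∈ I, ((r ^ 2 * mu M e Λ r * (ζ' r / ζ r) : ℝ) : ℂ) = V (ζ r))
    (hρ : ∀ r ∈ I, ρ (ζ r) = r)
    (hH : DifferentiableOn ℂ H (Metric.ball 0 1)) (hK : DifferentiableOn ℂ K (Metric.ball 0 1))
    (hHK : ∀ z : ℂ, ‖z‖ < 1 → K z = V z * (a * H z + z * deriv H z) ∧
      V z * (a * K z + z * deriv K z) = c ^ 2 * a ^ 2 * ρ z ^ 4 * H z)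
    (hω : ω ^ 2 = -(c ^ 2 * a ^ 2))
    (hR : ∀ r ∈ I, R r = C * (((|ζ r| : ℝ) : ℂ) ^ a * H (ζ r))) :
    SolvesODE M e Λ ω I R := by
  have hn : ∀ r ∈ I, ‖(ζ r : ℂ)‖ < 1 := fun r h => by
    simpa using hζ1 r h
  have hmem : ∀ r ∈ I, Metric.ball (0 : ℂ) 1 ∈ nhds (ζ r : ℂ) := fun r h =>
    Metric.isOpen_ball.mem_nhds (mem_ball_zero_iff.2 (hn r h))
  have hR' : ∀ r ∈ I, HasDerivAt R (C * (((|ζ r| : ℝ) : ℂ) ^ a *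
      (a * H (ζ r) + ζ r * deriv H (ζ r)) * ((ζ' r / ζ r : ℝ) : ℂ))) r := fun r h => by
    refine ((hasDerivAt_abs_cpow_mul (hζ r h) (hζ0 r h) a
      (hH.differentiableAt (hmem r h))).const_mul C).congr_of_eventuallyEq ?_
    filter_upwards [hI.mem_nhds h] with s hs using hR s hs
  have hW : ∀ r ∈ I, (r : ℂ) ^ 2 * (mu M e Λ r : ℂ) * deriv R r
      = C * (((|ζ r| : ℝ) : ℂ) ^ a * K (ζ r)) := fun r h => by
    rw [(hR' r h).deriv, (hHK _ (hn r h)).1, ← hPV r h]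
    push_cast
    ring
  have hW' : ∀ r ∈ I, HasDerivAt (fun s : ℝ => (s : ℂ) ^ 2 * (mu M e Λ s : ℂ) * deriv R s)
      (C * (((|ζ r| : ℝ) : ℂ) ^ a * (a * K (ζ r) + ζ r * deriv K (ζ r)) *
        ((ζ' r / ζ r : ℝ) : ℂ))) r := fun r h => by
    refine ((hasDerivAt_abs_cpow_mul (hζ r h) (hζ0 r h) a
      (hK.differentiableAt (hmem r h))).const_mul C).congr_of_eventuallyEq ?_
    filter_upwards [hI.mem_nhds h] with s hs using hW s hs
  have hmu : ∀ r ∈ I, (mu M e Λ r : ℂ) ≠ 0 := fun r h h0 => by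
    apply hV0 _ (hn r h)
    rw [← hPV r h, Complex.ofReal_eq_zero.1 h0]
    simp
  refine ⟨fun r h => (hR' r h).differentiableAt, fun r h => ?_, fun r h => ?_⟩
  · have hr0 : (r : ℂ) ≠ 0 := by exact_mod_cast hr r h
    have hmd : DifferentiableAt ℝ (fun s : ℝ => (mu M e Λ s : ℂ)) r :=
      ((differentiableAt_mu M e Λ (hr r h)).hasDerivAt.ofReal_comp).differentiableAt
    have hid : DifferentiableAt ℝ (fun s : ℝ => (s : ℂ)) r :=
      (hasDerivAt_id r).ofReal_comp.differentiableAt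
    refine ((hW' r h).differentiableAt.div ((hid.pow 2).mul hmd)
      (mul_ne_zero (pow_ne_zero 2 hr0) (hmu r h))).congr_of_eventuallyEq ?_
    filter_upwards [hI.mem_nhds h] with s hs
    have hs0 : (s : ℂ) ≠ 0 := by exact_mod_cast hr s hs
    have := hmu s hs
    simp only [Pi.div_apply, Pi.mul_apply, Pi.pow_apply]
    field_simp
  · have hr0 : (r : ℂ) ≠ 0 := by exact_mod_cast hr r h
    have h2 := (hHK _ (hn r h)).2
    rw [hρ r h, ← hPV r h] at h2
    push_cast at h2
    rw [(hW' r h).deriv, hω, hR r h]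
    push_cast
    have h3 : ((r : ℂ) ^ 2)⁻¹ * (r : ℂ) ^ 2 = 1 := inv_mul_cancel₀ (pow_ne_zero 2 hr0)
    linear_combination (((r : ℂ) ^ 2)⁻¹ ^ 2 * C * ((|ζ r| : ℝ) : ℂ) ^ a) * h2
      - (((r : ℂ) ^ 2)⁻¹ * mu M e Λ r * C * ((|ζ r| : ℝ) : ℂ) ^ a *
          (a * K (ζ r) + ζ r * deriv K (ζ r)) * (ζ' r / ζ r)
        - c ^ 2 * a ^ 2 * C * ((|ζ r| : ℝ) : ℂ) ^ a * H (ζ r) *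
          (1 + ((r : ℂ) ^ 2)⁻¹ * (r : ℂ) ^ 2)) * h3

/-! ### The metric coefficient and the Möbius variable -/

lemma sq_mul_mu_eq {M e Λ rm rp rc : ℝ} (h₀ : 0 < rm) (h₁ : rm < rp) (h₂ : rp < rc)
    (hzm : mu M e Λ rm = 0) (hzp : mu M e Λ rp = 0) (hzc : mu M e Λ rc = 0) {r : ℝ}
    (hr : r ≠ 0) :
    r ^ 2 * mu M e Λ r
      = Λ / 3 * (r - rm) * (r - rp) * (rc - r) * (r + rm + rp + rc) := by
  have hP : ∀ t : ℝ, t ≠ 0 →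
      t ^ 2 * mu M e Λ t = t ^ 2 - 2 * M * t + e ^ 2 - Λ / 3 * t ^ 4 := fun t ht => by
    unfold mu
    field_simp
  have hm := hP rm h₀.ne'
  have hp := hP rp (h₀.trans h₁).ne'
  have hc := hP rc ((h₀.trans h₁).trans h₂).ne'
  rw [hzm, mul_zero] at hm
  rw [hzp, mul_zero] at hp
  rw [hzc, mul_zero] at hc
  have d1 : (rm + rp) - 2 * M - Λ / 3 * (rm + rp) * (rm ^ 2 + rp ^ 2) = 0 := by
    refine (mul_eq_zero.1 (?_ : (rp - rm) * _ = 0)).resolve_left (sub_ne_zero.2 h₁.ne')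
    linear_combination hm - hp
  have d2 : (rp + rc) - 2 * M - Λ / 3 * (rp + rc) * (rp ^ 2 + rc ^ 2) = 0 := by
    refine (mul_eq_zero.1 (?_ : (rc - rp) * _ = 0)).resolve_left (sub_ne_zero.2 h₂.ne')
    linear_combination hp - hc
  have d3 : 1 - Λ / 3 * (rm ^ 2 + rp ^ 2 + rc ^ 2 + rm * rp + rp * rc + rm * rc) = 0 := by
    refine (mul_eq_zero.1 (?_ : (rc - rm) * _ = 0)).resolve_left
      (sub_ne_zero.2 (h₁.trans h₂).ne')
    linear_combination d2 - d1
  rw [hP r hr]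
  linear_combination (r - rp) * d1 + (r - rp) * (r - rm) * d3 - hp

lemma two_mul_sq_mul_kappaP {M e Λ rm rp rc : ℝ} (h₀ : 0 < rm) (h₁ : rm < rp) (h₂ : rp < rc)
    (hzm : mu M e Λ rm = 0) (hzp : mu M e Λ rp = 0) (hzc : mu M e Λ rc = 0) :
    2 * kappaP M e Λ rp * rp ^ 2
      = Λ / 3 * (rp - rm) * (rc - rp) * (rm + 2 * rp + rc) := by
  have hrp : rp ≠ 0 := (h₀.trans h₁).ne'
  have hd := (((hasDerivAt_id rp).pow 2).mul (differentiableAt_mu M e Λ hrp).hasDerivAt)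
  have hd' : HasDerivAt
      (fun r => (r - rp) * (Λ / 3 * (r - rm) * (rc - r) * (r + rm + rp + rc)))
      (Λ / 3 * (rp - rm) * (rc - rp) * (rm + 2 * rp + rc)) rp := by
    have hg : DifferentiableAt ℝ
      (fun r => Λ / 3 * (r - rm) * (rc - r) * (r + rm + rp + rc)) rp := by fun_prop
    refine (((hasDerivAt_id rp).sub_const rp).mul hg.hasDerivAt).congr_deriv ?_
    simp only [id]
    ring
  have := hd.unique (hd'.congr_of_eventuallyEq ?_)
  · simp only [hzp, id, Pi.pow_apply] at this
    rw [kappaP]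
    linear_combination this
  · filter_upwards [eventually_ne_nhds hrp] with r hr
    have := sq_mul_mu_eq h₀ h₁ h₂ hzm hzp hzc hr
    simp only [Pi.mul_apply, Pi.pow_apply, id, this]
    ring

lemma one_sub_ofReal_mul_ne_zero {t : ℝ} (ht : |t| < 1) {z : ℂ} (hz : ‖z‖ < 1) :
    1 - (t : ℂ) * z ≠ 0 := by
  intro h
  have h1 : ‖(t : ℂ) * z‖ = 1 := by rw [← sub_eq_zero.1 h, norm_one]
  rw [norm_mul, Complex.norm_real, Real.norm_eq_abs] at h1
  nlinarith [abs_nonneg t, norm_nonneg z]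

/-- A family of solutions `|r - r₊|ᵃ Ĥ(a, r)` of the radial equation with `ω² = -(2κ₊ a)²`,
with `Ĥ` regular across the event horizon and holomorphic in the exponent `a`. -/
theorem exists_event_horizon_family {M e Λ rm rp rc : ℝ} (hΛ : 0 < Λ)
    (h₀ : 0 < rm) (h₁ : rm < rp) (h₂ : rp < rc)
    (hzm : mu M e Λ rm = 0) (hzp : mu M e Λ rp = 0) (hzc : mu M e Λ rc = 0) :
    ∃ Φ : ℂ → ℝ → ℂ,
      (∀ a ∈ nonresonant, AnalyticOnNhd ℝ (Φ a) (Set.Ioo rm rc) ∧ Φ a rp = 1) ∧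
      (∀ r ∈ Set.Ioo rm rc, DifferentiableOn ℂ (fun a => Φ a r) nonresonant) ∧
      ∀ a ∈ nonresonant, ∀ ω : ℂ, ω ^ 2 = -((2 * (kappaP M e Λ rp : ℂ)) ^ 2 * a ^ 2) →
        ∀ I : Set ℝ, IsOpen I → I ⊆ Set.Ioo rm rc → rp ∉ I →
          SolvesODE M e Λ ω I (fun r => ((|r - rp| : ℝ) : ℂ) ^ a * Φ a r) := by
  obtain ⟨A, hA⟩ : ∃ A, A = rc - rp := ⟨_, rfl⟩
  obtain ⟨B, hB⟩ : ∃ B, B = rp - rm := ⟨_, rfl⟩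
  obtain ⟨D, hD⟩ : ∃ D, D = rm + 2 * rp + rc := ⟨_, rfl⟩
  have hA0 : 0 < A := by linarith
  have hB0 : 0 < B := by linarith
  have hD0 : 0 < D := by linarith
  have hDB : B < D := by linarith
  have hAB : 0 < A + B := by linarith
  obtain ⟨α, hα⟩ : ∃ α, α = (A - B) / (A + B) := ⟨_, rfl⟩
  obtain ⟨γ, hγ⟩ : ∃ γ, γ = 2 * A * B / (A + B) := ⟨_, rfl⟩
  obtain ⟨σ, hσ⟩ : ∃ σ, σ = (α * D - γ) / D := ⟨_, rfl⟩
  obtain ⟨v, hv⟩ : ∃ v, v = Λ / 3 * A * B * D := ⟨_, rfl⟩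
  have hγ0 : 0 < γ := by rw [hγ]; positivity
  have hv0 : 0 < v := by rw [hv]; positivity
  have hα1 : |α| < 1 := by
    rw [hα, abs_div, abs_of_pos hAB, div_lt_one hAB, abs_lt]
    constructor <;> linarith
  have hσ1 : |σ| < 1 := by
    have e1 : (α * D - γ) = ((A - B) * D - 2 * A * B) / (A + B) := by
      rw [hα, hγ]; field_simp
    rw [hσ, e1, div_div, abs_div, abs_of_pos (mul_pos hAB hD0), div_lt_one (mul_pos hAB hD0),
      abs_lt]
    constructor <;> nlinarith
  obtain ⟨L, hL⟩ : ∃ L : ℝ → ℝ, L = fun r => α * (r - rp) + γ := ⟨_, rfl⟩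
  have hLadd : ∀ r, L r + (r - rp) = 2 * A * (r - rm) / (A + B) := fun r => by
    rw [show rm = rp - B by linarith, hL, hα, hγ]; field_simp; ring
  have hLsub : ∀ r, L r - (r - rp) = 2 * B * (rc - r) / (A + B) := fun r => by
    rw [show rc = rp + A by linarith, hL, hα, hγ]; field_simp; ring
  have hadd : ∀ r ∈ Set.Ioo rm rc, 0 < L r + (r - rp) := fun r h => by
    have := sub_pos.2 h.1
    rw [hLadd]; positivity
  have hsub : ∀ r ∈ Set.Ioo rm rc, 0 < L r - (r - rp) := fun r h => by
    have := sub_pos.2 h.2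
    rw [hLsub]; positivity
  have hL0 : ∀ r ∈ Set.Ioo rm rc, 0 < L r := fun r h => by
    linarith [hadd r h, hsub r h]
  obtain ⟨ζ, hζ⟩ : ∃ ζ : ℝ → ℝ, ζ = fun r => (r - rp) / L r := ⟨_, rfl⟩
  have hζ1 : ∀ r ∈ Set.Ioo rm rc, |ζ r| < 1 := fun r h => by
    rw [hζ, abs_div, abs_of_pos (hL0 r h), div_lt_one (hL0 r h), abs_lt]
    constructor <;> linarith [hadd r h, hsub r h]
  have hζn : ∀ r ∈ Set.Ioo rm rc, ‖(ζ r : ℂ)‖ < 1 := fun r h => by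
    simpa using hζ1 r h
  have hLd : ∀ r, HasDerivAt L α r := fun r => by
    rw [hL]
    simpa using (((hasDerivAt_id r).sub_const rp).const_mul α).add_const γ
  have hζd : ∀ r ∈ Set.Ioo rm rc, HasDerivAt ζ (γ / L r ^ 2) r := fun r h => by
    rw [hζ]
    refine (((hasDerivAt_id r).sub_const rp).div (hLd r) (hL0 r h).ne').congr_deriv ?_
    congr 1
    simp only [id, hL]
    ring
  have hball : ∀ {t : ℝ}, |t| < 1 → ∀ z ∈ Metric.ball (0 : ℂ) 1, 1 - (t : ℂ) * z ≠ 0 :=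
    fun ht z hz => one_sub_ofReal_mul_ne_zero ht (mem_ball_zero_iff.1 hz)
  have hκ : v = 2 * kappaP M e Λ rp * rp ^ 2 := by
    rw [two_mul_sq_mul_kappaP h₀ h₁ h₂ hzm hzp hzc, hv, hA, hB, hD]; ring
  have hV0 : ∀ z : ℂ, ‖z‖ < 1 →
      (v : ℂ) * (1 - z ^ 2) * (1 - σ * z) / (1 - α * z) ^ 2 ≠ 0 := fun z hz => by
    refine div_ne_zero (mul_ne_zero (mul_ne_zero (by exact_mod_cast hv0.ne') ?_)
      (one_sub_ofReal_mul_ne_zero hσ1 hz)) (pow_ne_zero 2 (one_sub_ofReal_mul_ne_zero hα1 hz))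
    intro h
    have h1 : ‖z ^ 2‖ = 1 := by rw [← sub_eq_zero.1 h, norm_one]
    rw [norm_pow] at h1
    nlinarith [norm_nonneg z]
  obtain ⟨H, hHa, hHs⟩ := exists_frobenius_solution_sq
    (V := fun z => (v : ℂ) * (1 - z ^ 2) * (1 - σ * z) / (1 - α * z) ^ 2)
    (ρ := fun z => rp + γ * z / (1 - α * z)) (c := 2 * (kappaP M e Λ rp : ℂ))
    (DifferentiableOn.div (by fun_prop) (by fun_prop)
      fun z hz => pow_ne_zero 2 (hball hα1 z hz)) hV0
    (DifferentiableOn.add (by fun_prop) (DifferentiableOn.div (by fun_prop) (by fun_prop)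
      (hball hα1))) (by
        have : (v : ℂ) = 2 * (kappaP M e Λ rp : ℂ) * (rp : ℂ) ^ 2 := by exact_mod_cast hκ
        simpa using this)
  have hLrp : L rp = γ := by simp [hL]
  refine ⟨fun a r => Complex.exp (-a * (Real.log (L r / γ) : ℝ)) * H a (ζ r),
    fun a ha => ⟨fun r h => ?_, ?_⟩, fun r h => ?_, fun a ha ω hω I hI hIsub hrp => ?_⟩
  · have hLan : AnalyticAt ℝ L r := by
      rw [hL]
      exact (analyticAt_const.mul (analyticAt_id.sub analyticAt_const)).add analyticAt_const
    have hlog : AnalyticAt ℝ (fun s => (Real.log (L s / γ) : ℂ)) r :=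
      (Complex.ofRealCLM.analyticAt _).comp
        ((hLan.div analyticAt_const hγ0.ne').log (div_pos (hL0 r h) hγ0))
    have hζan : AnalyticAt ℝ (fun s => (ζ s : ℂ)) r := by
      refine (Complex.ofRealCLM.analyticAt _).comp ?_
      rw [hζ]
      exact (analyticAt_id.sub analyticAt_const).div hLan (hL0 r h).ne'
    have hexp : AnalyticAt ℝ Complex.exp (-a * (Real.log (L r / γ) : ℂ)) :=
      (analyticAt_cexp (z := -a * (Real.log (L r / γ) : ℂ))).restrictScalars
    have hHan : AnalyticAt ℝ (H a) (ζ r) :=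
      ((hHs a ha).1.analyticAt
        (Metric.isOpen_ball.mem_nhds (mem_ball_zero_iff.2 (hζn r h)))).restrictScalars
    exact (hexp.comp_of_eq (analyticAt_const.mul hlog) rfl).mul (hHan.comp_of_eq hζan rfl)
  · simp [hLrp, hζ, div_self hγ0.ne', (hHs a ha).2.1]
  · exact DifferentiableOn.mul (by fun_prop) (hHa _ (hζn r h))
  · obtain ⟨hHd, -, K, hK, hHK⟩ := hHs a ha
    have hx : ∀ r ∈ I, r - rp ≠ 0 := fun r h h0 => hrp (sub_eq_zero.1 h0 ▸ h)
    refine solvesODE_of_frobenius (C := Complex.exp (a * (Real.log γ : ℝ))) hI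
      (fun r h => (h₀.trans (hIsub h).1).ne') (fun r h => hζd r (hIsub h))
      (fun r h => ?_) (fun r h => hζ1 r (hIsub h)) hV0 (fun r h => ?_) (fun r h => ?_)
      hHd hK hHK hω fun r h => ?_
    · rw [hζ]
      exact div_ne_zero (hx r h) (hL0 r (hIsub h)).ne'
    · have hLr := (hL0 r (hIsub h)).ne'
      have hxr := hx r h
      have e1 : 1 - ζ r ^ 2
          = (2 * A * (r - rm) / (A + B)) * (2 * B * (rc - r) / (A + B)) / L r ^ 2 := by
        rw [← hLadd, ← hLsub, hζ]; field_simp; ring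
      have e2 : 1 - α * ζ r = γ / L r := by
        rw [hζ]; field_simp; rw [hL]; ring
      have e3 : 1 - σ * ζ r = γ * (r + rm + rp + rc) / (D * L r) := by
        rw [hζ, hσ]; field_simp; rw [hL, hD]; ring
      have e4 : r ^ 2 * mu M e Λ r * (γ / L r ^ 2 / ζ r)
          = v * (1 - ζ r ^ 2) * (1 - σ * ζ r) / (1 - α * ζ r) ^ 2 := by
        rw [e1, e2, e3, sq_mul_mu_eq h₀ h₁ h₂ hzm hzp hzc (h₀.trans (hIsub h).1).ne', hv, hζ, hγ]
        field_simp
      rw [e4]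
      push_cast
      ring
    · have hLr := (hL0 r (hIsub h)).ne'
      have e2 : 1 - α * ζ r = γ / L r := by
        rw [hζ]; field_simp; rw [hL]; ring
      have e3 : rp + γ * ζ r / (1 - α * ζ r) = r := by
        rw [e2, hζ]; field_simp; ring
      exact_mod_cast e3
    · have hLr := (hL0 r (hIsub h)).ne'
      have hζr : ζ r ≠ 0 := by
        rw [hζ]
        exact div_ne_zero (hx r h) hLr
      rw [abs_cpow_eq_exp (hx r h), abs_cpow_eq_exp hζr, ← mul_assoc, ← mul_assoc,
        ← Complex.exp_add, ← Complex.exp_add, hζ, Real.log_div (hx r h) hLr,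
        Real.log_div hLr hγ0.ne']
      congr 2
      push_cast
      ring

/-- Existence of the basis solutions `R_in,+`, `R_out,+` near `r = r₊`:
`R_{in/out}(ω,r) = |r - r₊|^(∓iω/(2κ₊))·Ĥ_{in/out}(ω,r)` with `Ĥ` real-analytic in `r`
on `(r₋, r_c)`, equal to `1` at `r₊`, holomorphic in `ω` on `𝒰`, solving the radial
o.d.e. with frequency `ω` on each of `(r₋, r₊)` and `(r₊, r_c)`. -/
theorem basis_solutions_event_horizon (M e Λ rm rp rc : ℝ)
    (hM : 0 < M) (he : 0 < e) (hΛ : 0 < Λ)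
    (h₀ : 0 < rm) (h₁ : rm < rp) (h₂ : rp < rc)
    (hzm : mu M e Λ rm = 0) (hzp : mu M e Λ rp = 0) (hzc : mu M e Λ rc = 0) :
    ∃ Hin Hout : ℂ → ℝ → ℂ,
      (∀ ω ∈ calU (kappaP M e Λ rp) (kappaM M e Λ rm) (kappaC M e Λ rc),
        AnalyticOnNhd ℝ (Hin ω) (Set.Ioo rm rc) ∧
        AnalyticOnNhd ℝ (Hout ω) (Set.Ioo rm rc) ∧
        Hin ω rp = 1 ∧ Hout ω rp = 1) ∧
      (∀ r ∈ Set.Ioo rm rc,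
        DifferentiableOn ℂ (fun ω => Hin ω r)
          (calU (kappaP M e Λ rp) (kappaM M e Λ rm) (kappaC M e Λ rc)) ∧
        DifferentiableOn ℂ (fun ω => Hout ω r)
          (calU (kappaP M e Λ rp) (kappaM M e Λ rm) (kappaC M e Λ rc))) ∧
      (∀ ω ∈ calU (kappaP M e Λ rp) (kappaM M e Λ rm) (kappaC M e Λ rc),
        SolvesODE M e Λ ω (Set.Ioo rm rp)
          (fun r => ((|r - rp| : ℝ) : ℂ) ^ (-(Complex.I * ω) / (2 * (kappaP M e Λ rp : ℂ))) * Hin ω r) ∧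
        SolvesODE M e Λ ω (Set.Ioo rp rc)
          (fun r => ((|r - rp| : ℝ) : ℂ) ^ (-(Complex.I * ω) / (2 * (kappaP M e Λ rp : ℂ))) * Hin ω r) ∧
        SolvesODE M e Λ ω (Set.Ioo rm rp)
          (fun r => ((|r - rp| : ℝ) : ℂ) ^ ((Complex.I * ω) / (2 * (kappaP M e Λ rp : ℂ))) * Hout ω r) ∧
        SolvesODE M e Λ ω (Set.Ioo rp rc)
          (fun r => ((|r - rp| : ℝ) : ℂ) ^ ((Complex.I * ω) / (2 * (kappaP M e Λ rp : ℂ))) * Hout ω r)) := by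
  obtain ⟨Φ, hΦr, hΦa, hΦs⟩ := exists_event_horizon_family hΛ h₀ h₁ h₂ hzm hzp hzc
  have hκ : (kappaP M e Λ rp : ℂ) ≠ 0 := by
    have h := two_mul_sq_mul_kappaP h₀ h₁ h₂ hzm hzp hzc
    have : 0 < Λ / 3 * (rp - rm) * (rc - rp) * (rm + 2 * rp + rc) :=
      mul_pos (mul_pos (mul_pos (by positivity) (by linarith)) (by linarith)) (by linarith)
    intro h0
    rw [Complex.ofReal_eq_zero.1 h0] at h
    linarith
  have hin : ∀ ω ∈ calU (kappaP M e Λ rp) (kappaM M e Λ rm) (kappaC M e Λ rc),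
      -(Complex.I * ω) / (2 * (kappaP M e Λ rp : ℂ)) ∈ nonresonant := fun ω hω n h => by
    refine hω (kappaP M e Λ rp) (by simp) (-(n + 1)) (by omega) ?_
    field_simp at h
    push_cast
    linear_combination Complex.I * h + ω * Complex.I_sq
  have hout : ∀ ω ∈ calU (kappaP M e Λ rp) (kappaM M e Λ rm) (kappaC M e Λ rc),
      (Complex.I * ω) / (2 * (kappaP M e Λ rp : ℂ)) ∈ nonresonant := fun ω hω n h => by
    refine hω (kappaP M e Λ rp) (by simp) (n + 1) (by omega) ?_
    field_simp at h
    push_cast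
    linear_combination (-Complex.I) * h + ω * Complex.I_sq
  have hsq_in : ∀ ω : ℂ, ω ^ 2 = -((2 * (kappaP M e Λ rp : ℂ)) ^ 2 *
      (-(Complex.I * ω) / (2 * (kappaP M e Λ rp : ℂ))) ^ 2) := fun ω => by
    field_simp
    linear_combination ω ^ 2 * Complex.I_sq
  have hsq_out : ∀ ω : ℂ, ω ^ 2 = -((2 * (kappaP M e Λ rp : ℂ)) ^ 2 *
      ((Complex.I * ω) / (2 * (kappaP M e Λ rp : ℂ))) ^ 2) := fun ω => by
    field_simp
    linear_combination ω ^ 2 * Complex.I_sq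
  have hleft : Set.Ioo rm rp ⊆ Set.Ioo rm rc := Set.Ioo_subset_Ioo_right h₂.le
  have hright : Set.Ioo rp rc ⊆ Set.Ioo rm rc := Set.Ioo_subset_Ioo_left h₁.le
  have hl : rp ∉ Set.Ioo rm rp := fun h => lt_irrefl _ h.2
  have hr : rp ∉ Set.Ioo rp rc := fun h => lt_irrefl _ h.1
  refine ⟨fun ω => Φ (-(Complex.I * ω) / (2 * (kappaP M e Λ rp : ℂ))),
    fun ω => Φ ((Complex.I * ω) / (2 * (kappaP M e Λ rp : ℂ))), fun ω hω => ?_, fun r h => ?_,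
    fun ω hω => ?_⟩
  · exact ⟨(hΦr _ (hin ω hω)).1, (hΦr _ (hout ω hω)).1, (hΦr _ (hin ω hω)).2,
      (hΦr _ (hout ω hω)).2⟩
  · exact ⟨(hΦa r h).comp (g := fun a => Φ a r) (by fun_prop) hin,
      (hΦa r h).comp (g := fun a => Φ a r) (by fun_prop) hout⟩
  · exact ⟨hΦs _ (hin ω hω) ω (hsq_in ω) _ isOpen_Ioo hleft hl,
      hΦs _ (hin ω hω) ω (hsq_in ω) _ isOpen_Ioo hright hr,
      hΦs _ (hout ω hω) ω (hsq_out ω) _ isOpen_Ioo hleft hl,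
      hΦs _ (hout ω hω) ω (hsq_out ω) _ isOpen_Ioo hright hr⟩
end
end
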